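/- arXiv:1210.1438 — 3 statements merged into one kernel-verified Lean document; each statement's English description precedes it below -/
import Mathlib

section
/- Let J be a B(H)-ideal and S ∈ J. Then ⟨S⟩_J is a B(H)-ideal if and only if (S)_J is a B(H)-ideal, and (S)_J^ℝ is a B(H)-ideal if and only if (S)_J is a B(H)-ideal. Moreover, in that case ⟨S⟩_J = (S)_J^ℝ = (S)_J = (S). -/
open scoped BigOperators
open TopologicalSpace

variable {H : Type*} [NormedAddCommGroup H] [InnerProductSpace ℂ H] [CompleteSpace H]

/-- `J` is a two-sided ideal of `B(H)`: an additive subgroup closed under left and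
right multiplication by arbitrary bounded operators. -/
def IsBHIdeal (J : Set (H →L[ℂ] H)) : Prop :=
  (0 : H →L[ℂ] H) ∈ J ∧
  (∀ x ∈ J, ∀ y ∈ J, x + y ∈ J) ∧
  (∀ x ∈ J, -x ∈ J) ∧
  ∀ (A : H →L[ℂ] H), ∀ x ∈ J, A * x ∈ J ∧ x * A ∈ J

/-- `I` is a `J`-ideal: an additive subgroup of `B(H)` contained in `J` and closed
under left and right multiplication by elements of `J`. -/
def IsSubideal (J I : Set (H →L[ℂ] H)) : Prop :=
  I ⊆ J ∧ (0 : H →L[ℂ] H) ∈ I ∧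
  (∀ x ∈ I, ∀ y ∈ I, x + y ∈ I) ∧
  (∀ x ∈ I, -x ∈ I) ∧
  ∀ A ∈ J, ∀ x ∈ I, A * x ∈ I ∧ x * A ∈ I

/-- A linear `J`-ideal: a `J`-ideal closed under multiplication by complex scalars. -/
def IsLinearSubideal (J I : Set (H →L[ℂ] H)) : Prop :=
  IsSubideal J I ∧ ∀ (c : ℂ), ∀ x ∈ I, c • x ∈ I

/-- A real linear `J`-ideal: a `J`-ideal closed under multiplication by real scalars. -/
def IsRealSubideal (J I : Set (H →L[ℂ] H)) : Prop :=
  IsSubideal J I ∧ ∀ (r : ℝ), ∀ x ∈ I, r • x ∈ I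

/-- `(𝒮)`: the smallest two-sided ideal of `B(H)` containing `𝒮`. -/
def genBH (𝒮 : Set (H →L[ℂ] H)) : Set (H →L[ℂ] H) :=
  ⋂₀ {I | IsBHIdeal I ∧ 𝒮 ⊆ I}

/-- `⟨𝒮⟩_J`: the smallest `J`-ideal containing `𝒮`. -/
def genSub (J 𝒮 : Set (H →L[ℂ] H)) : Set (H →L[ℂ] H) :=
  ⋂₀ {I | IsSubideal J I ∧ 𝒮 ⊆ I}

/-- `(𝒮)_J`: the smallest linear `J`-ideal containing `𝒮`. -/
def genLin (J 𝒮 : Set (H →L[ℂ] H)) : Set (H →L[ℂ] H) :=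
  ⋂₀ {I | IsLinearSubideal J I ∧ 𝒮 ⊆ I}

/-- `(𝒮)_J^ℝ`: the smallest real linear `J`-ideal containing `𝒮`. -/
def genReal (J 𝒮 : Set (H →L[ℂ] H)) : Set (H →L[ℂ] H) :=
  ⋂₀ {I | IsRealSubideal J I ∧ 𝒮 ⊆ I}

/-- `J(𝒮)`: all finite sums `Σ Aᵢ Xᵢ` with `Aᵢ ∈ J` and `Xᵢ ∈ (𝒮)`. -/
def JGen (J 𝒮 : Set (H →L[ℂ] H)) : Set (H →L[ℂ] H) :=
  {T | ∃ (n : ℕ) (A X : Fin n → (H →L[ℂ] H)),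
    (∀ i, A i ∈ J ∧ X i ∈ genBH 𝒮) ∧ T = ∑ i, A i * X i}

/-- `J(𝒮)J`: all finite sums `Σ Aᵢ Xᵢ Bᵢ` with `Aᵢ, Bᵢ ∈ J` and `Xᵢ ∈ (𝒮)`. -/
def JGenJ (J 𝒮 : Set (H →L[ℂ] H)) : Set (H →L[ℂ] H) :=
  {T | ∃ (n : ℕ) (A X B : Fin n → (H →L[ℂ] H)),
    (∀ i, A i ∈ J ∧ X i ∈ genBH 𝒮 ∧ B i ∈ J) ∧ T = ∑ i, A i * X i * B i}

/-- `JS + SJ + J(S)J = {AS + SB + Y : A, B ∈ J, Y ∈ J(S)J}`. -/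
def JSplus (J : Set (H →L[ℂ] H)) (S : H →L[ℂ] H) : Set (H →L[ℂ] H) :=
  {T | ∃ A ∈ J, ∃ B ∈ J, ∃ Y ∈ JGenJ J {S}, T = A * S + S * B + Y}

/-- `K(H)`: the compact operators on `H`. -/
def KH : Set (H →L[ℂ] H) := {T | IsCompactOperator ⇑T}

/-- `T` is a finite-rank operator: its range is finite-dimensional. -/
def IsFiniteRank (T : H →L[ℂ] H) : Prop :=
  FiniteDimensional ℂ (LinearMap.range (T : H →ₗ[ℂ] H))

section Subideals

variable {E : Type*} [NormedAddCommGroup E] [InnerProductSpace ℂ E]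

theorem IsBHIdeal.smul_mem {J : Set (E →L[ℂ] E)} (hJ : IsBHIdeal J) (c : ℂ)
    {x : E →L[ℂ] E} (hx : x ∈ J) : c • x ∈ J := by
  simpa using (hJ.2.2.2 (c • 1) x hx).1

/-- A two-sided ideal of `B(E)` contained in `J` is a linear `J`-ideal. -/
theorem IsBHIdeal.isLinearSubideal {J I : Set (E →L[ℂ] E)} (hI : IsBHIdeal I) (hIJ : I ⊆ J) :
    IsLinearSubideal J I :=
  ⟨⟨hIJ, hI.1, hI.2.1, hI.2.2.1, fun A _ x hx => hI.2.2.2 A x hx⟩,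
    fun c _ hx => hI.smul_mem c hx⟩

theorem IsLinearSubideal.isRealSubideal {J I : Set (E →L[ℂ] E)} (hI : IsLinearSubideal J I) :
    IsRealSubideal J I :=
  ⟨hI.1, fun r x hx => by simpa using hI.2 (r : ℂ) x hx⟩

theorem isBHIdeal_genBH (𝒮 : Set (E →L[ℂ] E)) : IsBHIdeal (genBH 𝒮) := by
  refine ⟨fun I hI => hI.1.1, fun x hx y hy I hI => hI.1.2.1 x (hx I hI) y (hy I hI),
    fun x hx I hI => hI.1.2.2.1 x (hx I hI), fun A x hx => ⟨fun I hI => ?_, fun I hI => ?_⟩⟩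
  · exact (hI.1.2.2.2 A x (hx I hI)).1
  · exact (hI.1.2.2.2 A x (hx I hI)).2

theorem genSub_subset_genReal (J 𝒮 : Set (E →L[ℂ] E)) : genSub J 𝒮 ⊆ genReal J 𝒮 :=
  fun _ hx I hI => hx I ⟨hI.1.1, hI.2⟩

theorem genReal_subset_genLin (J 𝒮 : Set (E →L[ℂ] E)) : genReal J 𝒮 ⊆ genLin J 𝒮 :=
  fun _ hx I hI => hx I ⟨hI.1.isRealSubideal, hI.2⟩

theorem genLin_subset_genBH {J 𝒮 : Set (E →L[ℂ] E)} (hJ : IsBHIdeal J) (h𝒮 : 𝒮 ⊆ J) :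
    genLin J 𝒮 ⊆ genBH 𝒮 :=
  fun _ hx => hx _ ⟨(isBHIdeal_genBH 𝒮).isLinearSubideal fun _ hy => hy J ⟨hJ, h𝒮⟩,
    fun _ hy _ hI => hI.2 hy⟩

theorem subset_genLin (J 𝒮 : Set (E →L[ℂ] E)) : 𝒮 ⊆ genLin J 𝒮 :=
  fun _ hx _ hI => hI.2 hx

theorem subset_genSub (J 𝒮 : Set (E →L[ℂ] E)) : 𝒮 ⊆ genSub J 𝒮 :=
  fun _ hx _ hI => hI.2 hx

/-- The additive subgroup `JS + SJ + JSJ`. -/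
def softPart (J : Set (E →L[ℂ] E)) (S : E →L[ℂ] E) : AddSubgroup (E →L[ℂ] E) :=
  AddSubgroup.closure ({T | ∃ A ∈ J, T = A * S} ∪ {T | ∃ B ∈ J, T = S * B} ∪
    {T | ∃ A ∈ J, ∃ B ∈ J, T = A * S * B})

section softPart

variable {J : Set (E →L[ℂ] E)} {S : E →L[ℂ] E}

theorem mul_gen_mem_softPart {A : E →L[ℂ] E} (hA : A ∈ J) : A * S ∈ softPart J S :=
  AddSubgroup.subset_closure (Or.inl (Or.inl ⟨A, hA, rfl⟩))

theorem gen_mul_mem_softPart {B : E →L[ℂ] E} (hB : B ∈ J) : S * B ∈ softPart J S :=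
  AddSubgroup.subset_closure (Or.inl (Or.inr ⟨B, hB, rfl⟩))

theorem mul_gen_mul_mem_softPart {A B : E →L[ℂ] E} (hA : A ∈ J) (hB : B ∈ J) :
    A * S * B ∈ softPart J S :=
  AddSubgroup.subset_closure (Or.inr ⟨A, hA, B, hB, rfl⟩)

/-- To show that an additive map sends `softPart J S` to itself it suffices to look at the
three kinds of generators. -/
theorem map_mem_softPart (f : (E →L[ℂ] E) →+ (E →L[ℂ] E))
    (hl : ∀ A ∈ J, f (A * S) ∈ softPart J S) (hr : ∀ B ∈ J, f (S * B) ∈ softPart J S)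
    (hlr : ∀ A ∈ J, ∀ B ∈ J, f (A * S * B) ∈ softPart J S) {x : E →L[ℂ] E}
    (hx : x ∈ softPart J S) : f x ∈ softPart J S := by
  suffices h : softPart J S ≤ (softPart J S).comap f from h hx
  refine (AddSubgroup.closure_le _).2 ?_
  rintro _ ((⟨A, hA, rfl⟩ | ⟨B, hB, rfl⟩) | ⟨A, hA, B, hB, rfl⟩)
  exacts [hl A hA, hr B hB, hlr A hA B hB]

theorem smul_mem_softPart (hJ : IsBHIdeal J) (c : ℂ) {x : E →L[ℂ] E}
    (hx : x ∈ softPart J S) : c • x ∈ softPart J S := by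
  refine map_mem_softPart (DistribSMul.toAddMonoidHom _ c) (fun A hA => ?_) (fun B hB => ?_)
    (fun A hA B hB => ?_) hx
  · simpa using mul_gen_mem_softPart (S := S) (hJ.smul_mem c hA)
  · simpa using gen_mul_mem_softPart (S := S) (hJ.smul_mem c hB)
  · simpa using mul_gen_mul_mem_softPart (S := S) (hJ.smul_mem c hA) hB

theorem mul_mem_softPart (hJ : IsBHIdeal J) {A x : E →L[ℂ] E} (hA : A ∈ J)
    (hx : x ∈ softPart J S) : A * x ∈ softPart J S := by
  refine map_mem_softPart (AddMonoidHom.mulLeft A) (fun A' hA' => ?_) (fun B hB => ?_)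
    (fun A' hA' B hB => ?_) hx
  · simpa [mul_assoc] using mul_gen_mem_softPart (S := S) (hJ.2.2.2 A A' hA').1
  · simpa [mul_assoc] using mul_gen_mul_mem_softPart (S := S) hA hB
  · simpa [mul_assoc] using mul_gen_mul_mem_softPart (S := S) (hJ.2.2.2 A A' hA').1 hB

theorem mem_softPart_mul (hJ : IsBHIdeal J) {B x : E →L[ℂ] E} (hB : B ∈ J)
    (hx : x ∈ softPart J S) : x * B ∈ softPart J S := by
  refine map_mem_softPart (AddMonoidHom.mulRight B) (fun A hA => ?_) (fun B' hB' => ?_)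
    (fun A hA B' hB' => ?_) hx
  · simpa [mul_assoc] using mul_gen_mul_mem_softPart (S := S) hA hB
  · simpa [mul_assoc] using gen_mul_mem_softPart (S := S) (hJ.2.2.2 B B' hB').2
  · simpa [mul_assoc] using mul_gen_mul_mem_softPart (S := S) hA (hJ.2.2.2 B B' hB').2

theorem softPart_subset {I : Set (E →L[ℂ] E)} (hI : IsSubideal J I) (hS : S ∈ I) :
    (softPart J S : Set (E →L[ℂ] E)) ⊆ I := by
  obtain ⟨-, h0, hadd, hneg, hmul⟩ := hI
  let K : AddSubgroup (E →L[ℂ] E) :=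
    { carrier := I
      zero_mem' := h0
      add_mem' := fun {a b} ha hb => hadd a ha b hb
      neg_mem' := fun {a} ha => hneg a ha }
  suffices h : softPart J S ≤ K from h
  refine (AddSubgroup.closure_le _).2 ?_
  rintro _ ((⟨A, hA, rfl⟩ | ⟨B, hB, rfl⟩) | ⟨A, hA, B, hB, rfl⟩)
  exacts [(hmul A hA S hS).1, (hmul B hB S hS).2, (hmul B hB _ (hmul A hA S hS).1).2]

theorem softPart_subset_genSub : (softPart J S : Set (E →L[ℂ] E)) ⊆ genSub J {S} :=
  fun _ hx _ hI => softPart_subset hI.1 (hI.2 rfl) hx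

/-- Every element of `(S)_J` lies in `ℂS + (JS + SJ + JSJ)`. -/
theorem exists_smul_add_of_mem_genLin (hJ : IsBHIdeal J) (hS : S ∈ J) {T : E →L[ℂ] E}
    (hT : T ∈ genLin J {S}) : ∃ c : ℂ, ∃ i ∈ softPart J S, T = c • S + i := by
  have hsub : (softPart J S : Set (E →L[ℂ] E)) ⊆ J :=
    softPart_subset (hJ.isLinearSubideal subset_rfl).1 hS
  refine hT {T | ∃ c : ℂ, ∃ i ∈ softPart J S, T = c • S + i}
    ⟨⟨⟨?_, ⟨0, 0, zero_mem _, by simp⟩, ?_, ?_, ?_⟩, ?_⟩, ?_⟩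
  · rintro _ ⟨c, i, hi, rfl⟩
    exact hJ.2.1 _ (hJ.smul_mem c hS) _ (hsub hi)
  · rintro _ ⟨c, i, hi, rfl⟩ _ ⟨d, j, hj, rfl⟩
    exact ⟨c + d, i + j, add_mem hi hj, by rw [add_smul]; abel⟩
  · rintro _ ⟨c, i, hi, rfl⟩
    exact ⟨-c, -i, neg_mem hi, by rw [neg_smul]; abel⟩
  · rintro A hA _ ⟨c, i, hi, rfl⟩
    refine ⟨⟨0, _, add_mem (smul_mem_softPart hJ c (mul_gen_mem_softPart hA))
      (mul_mem_softPart hJ hA hi), ?_⟩, ⟨0, _, add_mem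
      (smul_mem_softPart hJ c (gen_mul_mem_softPart hA)) (mem_softPart_mul hJ hA hi), ?_⟩⟩
    · simp [mul_add]
    · simp [add_mul]
  · rintro d _ ⟨c, i, hi, rfl⟩
    exact ⟨d * c, d • i, smul_mem_softPart hJ d hi, by rw [smul_add, mul_smul]⟩
  · rintro _ rfl
    exact ⟨1, 0, zero_mem _, by simp⟩

/-- If `(S)_J` is a two-sided ideal of `B(E)`, then so is `JS + SJ + JSJ`. -/
theorem isBHIdeal_softPart (hJ : IsBHIdeal J) (hS : S ∈ J) (h : IsBHIdeal (genLin J {S})) :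
    IsBHIdeal (softPart J S : Set (E →L[ℂ] E)) := by
  have hSL : S ∈ genLin J {S} := subset_genLin J {S} rfl
  refine ⟨zero_mem _, fun x hx y hy => add_mem hx hy, fun x hx => neg_mem hx,
    fun T x hx => ⟨?_, ?_⟩⟩
  · obtain ⟨c, i, hi, hc⟩ := exists_smul_add_of_mem_genLin hJ hS (h.2.2.2 T S hSL).1
    refine map_mem_softPart (AddMonoidHom.mulLeft T) (fun A hA => ?_) (fun B hB => ?_)
      (fun A hA B hB => ?_) hx
    · simpa [mul_assoc] using mul_gen_mem_softPart (S := S) (hJ.2.2.2 T A hA).1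
    · have := add_mem (smul_mem_softPart hJ c (gen_mul_mem_softPart hB))
        (mem_softPart_mul hJ hB hi)
      simpa [← mul_assoc, hc, add_mul] using this
    · simpa [mul_assoc] using mul_gen_mul_mem_softPart (S := S) (hJ.2.2.2 T A hA).1 hB
  · obtain ⟨c, i, hi, hc⟩ := exists_smul_add_of_mem_genLin hJ hS (h.2.2.2 T S hSL).2
    refine map_mem_softPart (AddMonoidHom.mulRight T) (fun A hA => ?_) (fun B hB => ?_)
      (fun A hA B hB => ?_) hx
    · have := add_mem (smul_mem_softPart hJ c (mul_gen_mem_softPart hA))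
        (mul_mem_softPart hJ hA hi)
      simpa [mul_assoc, hc, mul_add] using this
    · simpa [mul_assoc] using gen_mul_mem_softPart (S := S) (hJ.2.2.2 T B hB).2
    · simpa [mul_assoc] using mul_gen_mul_mem_softPart (S := S) hA (hJ.2.2.2 T B hB).2

end softPart

/-- On a finite-dimensional space, a two-sided ideal with a nonzero element contains `1`. -/
theorem IsBHIdeal.one_mem [FiniteDimensional ℂ E] {J : Set (E →L[ℂ] E)} (hJ : IsBHIdeal J)
    {S : E →L[ℂ] E} (hS : S ∈ J) (hS0 : S ≠ 0) : (1 : E →L[ℂ] E) ∈ J := by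
  obtain ⟨x, hx⟩ : ∃ x, S x ≠ 0 := by
    by_contra! h
    exact hS0 (ContinuousLinearMap.ext h)
  have hrank : ∀ y : E, InnerProductSpace.rankOne ℂ y y ∈ J := fun y => by
    have h := hJ.smul_mem ((inner ℂ (S x) (S x))⁻¹)
      (hJ.2.2.2 (InnerProductSpace.rankOne ℂ y (S x)) _
        (hJ.2.2.2 (InnerProductSpace.rankOne ℂ x y) S hS).2).1
    convert h using 1
    rw [ContinuousLinearMap.mul_def, ContinuousLinearMap.mul_def,
      InnerProductSpace.comp_rankOne, InnerProductSpace.rankOne_comp_rankOne,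
      inv_smul_smul₀ (inner_self_ne_zero.2 hx)]
  have hsum := (stdOrthonormalBasis ℂ E).sum_rankOne_eq_id
  let K : AddSubgroup (E →L[ℂ] E) :=
    { carrier := J
      zero_mem' := hJ.1
      add_mem' := fun {a b} ha hb => hJ.2.1 a ha b hb
      neg_mem' := fun {a} ha => hJ.2.2.1 a ha }
  have h1 : (∑ i, InnerProductSpace.rankOne ℂ (stdOrthonormalBasis ℂ E i)
      (stdOrthonormalBasis ℂ E i)) ∈ K := sum_mem fun i _ => hrank _
  rw [hsum] at h1
  exact h1

end Subideals

/-- An infinite-dimensional Hilbert space admits two isometries with orthogonal ranges. -/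
theorem exists_isometries_orthogonal_ranges (hH : ¬ FiniteDimensional ℂ H) :
    ∃ V W V' W' : H →L[ℂ] H, V' * V = 1 ∧ W' * W = 1 ∧ V' * W = 0 := by
  obtain ⟨w, b, -⟩ := exists_hilbertBasis ℂ H
  have hinf : Infinite w := by
    by_contra hfin
    rw [not_infinite_iff_finite] at hfin
    have := Fintype.ofFinite w
    exact hH b.toOrthonormalBasis.toBasis.finiteDimensional_of_finite
  obtain ⟨e⟩ : Nonempty (w ⊕ w ≃ w) :=
    Cardinal.eq.1 (by rw [← Cardinal.add_def, Cardinal.add_mk_eq_max, max_self])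
  have key : ∀ f : w → w, f.Injective →
      ∃ V : H →L[ℂ] H, V.adjoint * V = 1 ∧ ∀ i, V (b i) = b (f i) := by
    classical
    intro f hf
    let U : H →ₗᵢ[ℂ] H := (b.orthonormal.comp f hf).orthogonalFamily.linearIsometry.comp
      b.repr.toLinearIsometry
    refine ⟨U.toContinuousLinearMap,
      (ContinuousLinearMap.norm_map_iff_adjoint_comp_self _).1 U.norm_map, fun i => ?_⟩
    change (b.orthonormal.comp f hf).orthogonalFamily.linearIsometry (b.repr (b i)) = _
    rw [b.repr_self, OrthogonalFamily.linearIsometry_apply_single]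
    simp
  obtain ⟨V, hV, hVb⟩ := key (e ∘ Sum.inl) (e.injective.comp Sum.inl_injective)
  obtain ⟨W, hW, hWb⟩ := key (e ∘ Sum.inr) (e.injective.comp Sum.inr_injective)
  refine ⟨V, W, V.adjoint, W.adjoint, hV, hW, ?_⟩
  have hd : Dense (Submodule.span ℂ (Set.range b) : Set H) :=
    Submodule.dense_iff_topologicalClosure_eq_top.2 b.dense_span
  refine ContinuousLinearMap.ext_on hd ?_
  rintro _ ⟨i, rfl⟩
  refine b.repr.map_eq_zero_iff.1 (lp.ext (funext fun j => ?_))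
  rw [b.repr_apply_apply, mul_apply_eq_comp,
    ContinuousLinearMap.adjoint_inner_right, hVb, hWb]
  exact b.orthonormal.2 fun h => by simpa using e.injective h

/-- If `(S)_J` is a two-sided ideal of `B(H)`, then `S ∈ JS + SJ + JSJ`. -/
theorem mem_softPart_of_isBHIdeal_genLin {J : Set (H →L[ℂ] H)} {S : H →L[ℂ] H}
    (hJ : IsBHIdeal J) (hS : S ∈ J) (h : IsBHIdeal (genLin J {S})) : S ∈ softPart J S := by
  by_cases hH : FiniteDimensional ℂ H
  · rcases eq_or_ne S 0 with rfl | hS0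
    · exact zero_mem _
    · simpa using mul_gen_mem_softPart (S := S) (hJ.one_mem hS hS0)
  by_contra hSI
  obtain ⟨V, W, V', W', hV, hW, hVW⟩ := exists_isometries_orthogonal_ranges hH
  have hI := isBHIdeal_softPart hJ hS h
  have hscalar : ∀ T : H →L[ℂ] H, ∃ c : ℂ, T * S - c • S ∈ softPart J S := fun T => by
    obtain ⟨c, i, hi, hc⟩ := exists_smul_add_of_mem_genLin hJ hS
      (h.2.2.2 T S (subset_genLin J {S} rfl)).1
    exact ⟨c, by simpa [hc] using hi⟩
  have hprod : ∀ {T T' : H →L[ℂ] H} {c c' d : ℂ}, T * S - c • S ∈ softPart J S →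
      T' * S - c' • S ∈ softPart J S → T' * T = d • 1 → c * c' = d := by
    intro T T' c c' d hT hT' hd
    by_contra hne
    have hmem := add_mem (hI.2.2.2 T' _ hT).1 (smul_mem_softPart hJ c hT')
    have heq : T' * (T * S - c • S) + c • (T' * S - c' • S) = (d - c * c') • S := by
      rw [mul_sub, ← mul_assoc, hd, mul_smul_comm, smul_sub, smul_smul, sub_smul, smul_mul_assoc,
        one_mul]
      abel
    rw [heq] at hmem
    refine hSI ?_
    have := smul_mem_softPart hJ (d - c * c')⁻¹ hmem
    rwa [inv_smul_smul₀ (sub_ne_zero.2 (Ne.symm hne))] at this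
  obtain ⟨v, hv⟩ := hscalar V
  obtain ⟨v', hv'⟩ := hscalar V'
  obtain ⟨w, hw⟩ := hscalar W
  obtain ⟨w', hw'⟩ := hscalar W'
  have h1 : v * v' = 1 := hprod hv hv' (by simpa using hV)
  have h2 : w * w' = 1 := hprod hw hw' (by simpa using hW)
  have h3 : w * v' = 0 := hprod hw hv' (by simpa using hVW)
  rcases mul_eq_zero.1 h3 with h0 | h0 <;> simp [h0] at h1 h2

/-- `⟨S⟩_J` (resp. `(S)_J^ℝ`) is a `B(H)`-ideal iff `(S)_J` is, and in
that case all three coincide with `(S)`. -/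
theorem stmt_2 (J : Set (H →L[ℂ] H)) (hJ : IsBHIdeal J)
    (S : H →L[ℂ] H) (hS : S ∈ J) :
    (IsBHIdeal (genSub J {S}) ↔ IsBHIdeal (genLin J {S})) ∧
    (IsBHIdeal (genReal J {S}) ↔ IsBHIdeal (genLin J {S})) ∧
    (IsBHIdeal (genLin J {S}) →
      genSub J {S} = genBH {S} ∧ genReal J {S} = genBH {S} ∧
      genLin J {S} = genBH {S}) := by
  have hgen : IsBHIdeal (genLin J {S}) →
      genSub J {S} = genBH {S} ∧ genReal J {S} = genBH {S} ∧ genLin J {S} = genBH {S} := by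
    intro h
    have hBS : genBH {S} ⊆ genSub J {S} := fun T hT => softPart_subset_genSub
      (hT _ ⟨isBHIdeal_softPart hJ hS h,
        Set.singleton_subset_iff.2 (mem_softPart_of_isBHIdeal_genLin hJ hS h)⟩)
    have hSR := genSub_subset_genReal J {S}
    have hRL := genReal_subset_genLin J {S}
    have hLB : genLin J {S} ⊆ genBH {S} :=
      genLin_subset_genBH hJ (Set.singleton_subset_iff.2 hS)
    exact ⟨((hSR.trans hRL).trans hLB).antisymm hBS,
      (hRL.trans hLB).antisymm (hBS.trans hSR), hLB.antisymm ((hBS.trans hSR).trans hRL)⟩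
  have hJL : IsSubideal J J := (hJ.isLinearSubideal subset_rfl).1
  refine ⟨⟨fun h => ?_, fun h => ?_⟩, ⟨fun h => ?_, fun h => ?_⟩, hgen⟩
  · have hLS : genLin J {S} ⊆ genSub J {S} := fun T hT => hT _
      ⟨h.isLinearSubideal fun x hx => hx J ⟨hJL, Set.singleton_subset_iff.2 hS⟩,
        subset_genSub J {S}⟩
    rwa [hLS.antisymm ((genSub_subset_genReal J {S}).trans (genReal_subset_genLin J {S}))]
  · rw [(hgen h).1]
    exact isBHIdeal_genBH {S}
  · have hLR : genLin J {S} ⊆ genReal J {S} := fun T hT => hT _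
      ⟨h.isLinearSubideal fun x hx => hx J ⟨(hJ.isLinearSubideal subset_rfl).isRealSubideal,
        Set.singleton_subset_iff.2 hS⟩,
        (subset_genSub J {S}).trans (genSub_subset_genReal J {S})⟩
    rwa [hLR.antisymm (genReal_subset_genLin J {S})]
  · rw [(hgen h).2.1]
    exact isBHIdeal_genBH {S}
end

section
/- There exists a compact operator S on H such that the principal K(H)-ideal ⟨S⟩_{K(H)} is not closed under multiplication by complex scalars; specifically, iS ∉ ⟨S⟩_{K(H)} where i = √(-1). (Such an S is the diagonal operator with singular values ⟨1/n⟩.) -/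
open scoped BigOperators
open TopologicalSpace

variable {H : Type*} [NormedAddCommGroup H] [InnerProductSpace ℂ H] [CompleteSpace H]

/-- The operators whose approximation numbers along the ranks `2 ^ n` are `o(2 ^ (-n))`. -/
def littleO : Set (H →L[ℂ] H) :=
  {T | ∀ ε : ℝ, 0 < ε → ∃ N : ℕ, ∀ n ≥ N, ∃ F : H →L[ℂ] H,
    (F : H →ₗ[ℂ] H).rank ≤ 2 ^ n ∧ ‖T - F‖ ≤ ε / 2 ^ n}

/-- The operators whose approximation numbers along the ranks `2 ^ n` are `O(2 ^ (-n))`. -/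
def bigO : Set (H →L[ℂ] H) :=
  {T | ∃ C : ℝ, 0 < C ∧ ∀ n : ℕ, ∃ F : H →L[ℂ] H,
    (F : H →ₗ[ℂ] H).rank ≤ 2 ^ n ∧ ‖T - F‖ ≤ C / 2 ^ n}

omit [CompleteSpace H] in
lemma rank_clm_add_le (F G : H →L[ℂ] H) :
    ((F + G : H →L[ℂ] H) : H →ₗ[ℂ] H).rank ≤
      (F : H →ₗ[ℂ] H).rank + (G : H →ₗ[ℂ] H).rank :=
  LinearMap.rank_add_le _ _

omit [CompleteSpace H] in
lemma rank_clm_mul_le_left (F G : H →L[ℂ] H) :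
    ((F * G : H →L[ℂ] H) : H →ₗ[ℂ] H).rank ≤ (F : H →ₗ[ℂ] H).rank :=
  LinearMap.rank_comp_le_left (G : H →ₗ[ℂ] H) (F : H →ₗ[ℂ] H)

omit [CompleteSpace H] in
lemma rank_clm_mul_le_right (F G : H →L[ℂ] H) :
    ((F * G : H →L[ℂ] H) : H →ₗ[ℂ] H).rank ≤ (G : H →ₗ[ℂ] H).rank :=
  LinearMap.rank_comp_le_right (G : H →ₗ[ℂ] H) (F : H →ₗ[ℂ] H)

omit [CompleteSpace H] in
lemma isCompactOperator_of_rank_lt {F : H →L[ℂ] H}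
    (hF : (F : H →ₗ[ℂ] H).rank < Cardinal.aleph0) : IsCompactOperator ⇑F := by
  have : FiniteDimensional ℂ (LinearMap.range (F : H →ₗ[ℂ] H)) :=
    Module.rank_lt_aleph0_iff.mp hF
  have hpr : ProperSpace (LinearMap.range (F : H →ₗ[ℂ] H)) :=
    FiniteDimensional.proper ℂ _
  let G : H →L[ℂ] LinearMap.range (F : H →ₗ[ℂ] H) :=
    F.codRestrict _ fun x => LinearMap.mem_range_self _ x
  exact (isCompactOperator_of_locallyCompactSpace_rng
    (LinearMap.range (F : H →ₗ[ℂ] H)).subtypeL).comp_clm G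

lemma two_pow_lt_aleph0 (n : ℕ) : (2 : Cardinal) ^ n < Cardinal.aleph0 := by
  exact_mod_cast Cardinal.natCast_lt_aleph0 (n := 2 ^ n)

lemma isCompactOperator_of_forall_exists {T : H →L[ℂ] H}
    (h : ∀ ε : ℝ, 0 < ε → ∃ F : H →L[ℂ] H,
      (F : H →ₗ[ℂ] H).rank < Cardinal.aleph0 ∧ ‖T - F‖ < ε) : IsCompactOperator ⇑T := by
  have hc := isClosed_setOfPred_isCompactOperator (σ₁₂ := RingHom.id ℂ) (M₁ := H) (M₂ := H)
  refine hc.closure_subset (Metric.mem_closure_iff.mpr fun ε hε => ?_)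
  obtain ⟨F, hF, hn⟩ := h ε hε
  exact ⟨F, isCompactOperator_of_rank_lt hF, by rwa [dist_eq_norm]⟩

lemma tendsto_div_two_pow (C : ℝ) :
    Filter.Tendsto (fun n : ℕ => C / 2 ^ n) Filter.atTop (nhds 0) := by
  simpa [div_eq_mul_inv] using
    (tendsto_pow_atTop_nhds_zero_of_lt_one (r := (2 : ℝ)⁻¹) (by norm_num)
      (by norm_num)).const_mul C

lemma littleO_subset_compact : littleO (H := H) ⊆ KH := by
  intro T hT
  refine isCompactOperator_of_forall_exists fun ε hε => ?_
  obtain ⟨N, hN⟩ := hT 1 one_pos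
  obtain ⟨n, hn, hnN⟩ := (((tendsto_div_two_pow 1).eventually_lt_const hε).and
    (Filter.eventually_ge_atTop N)).exists
  obtain ⟨F, hF, hFn⟩ := hN n hnN
  exact ⟨F, hF.trans_lt (two_pow_lt_aleph0 n), hFn.trans_lt hn⟩

lemma bigO_subset_compact : bigO (H := H) ⊆ KH := by
  rintro T ⟨C, -, hT⟩
  refine isCompactOperator_of_forall_exists fun ε hε => ?_
  obtain ⟨n, hn⟩ := ((tendsto_div_two_pow C).eventually_lt_const hε).exists
  obtain ⟨F, hF, hFn⟩ := hT n
  exact ⟨F, hF.trans_lt (two_pow_lt_aleph0 n), hFn.trans_lt hn⟩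

omit [CompleteSpace H] in
lemma littleO_zero : (0 : H →L[ℂ] H) ∈ littleO := fun ε hε =>
  ⟨0, fun n _ => ⟨0, by simp [LinearMap.rank_zero], by simp; positivity⟩⟩

omit [CompleteSpace H] in
lemma littleO_add {S T : H →L[ℂ] H} (hS : S ∈ littleO) (hT : T ∈ littleO) :
    S + T ∈ littleO := by
  intro ε hε
  obtain ⟨M, hM⟩ := hS (ε / 4) (by positivity)
  obtain ⟨N, hN⟩ := hT (ε / 4) (by positivity)
  refine ⟨max M N + 1, fun n hn => ?_⟩
  obtain ⟨n, rfl⟩ : ∃ m, n = m + 1 := ⟨n - 1, by omega⟩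
  obtain ⟨F, hF, hSF⟩ := hM n (by omega)
  obtain ⟨G, hG, hTG⟩ := hN n (by omega)
  refine ⟨F + G, (rank_clm_add_le F G).trans ((add_le_add hF hG).trans_eq (by ring)), ?_⟩
  calc ‖S + T - (F + G)‖ = ‖(S - F) + (T - G)‖ := by congr 1; abel
    _ ≤ ε / 4 / 2 ^ n + ε / 4 / 2 ^ n := (norm_add_le _ _).trans (add_le_add hSF hTG)
    _ = ε / 2 ^ (n + 1) := by field_simp; ring

omit [CompleteSpace H] in
lemma littleO_mul_left (A : H →L[ℂ] H) {T : H →L[ℂ] H} (hT : T ∈ littleO) :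
    A * T ∈ littleO := by
  intro ε hε
  obtain ⟨N, hN⟩ := hT (ε / (‖A‖ + 1)) (by positivity)
  refine ⟨N, fun n hn => ?_⟩
  obtain ⟨F, hF, hTF⟩ := hN n hn
  refine ⟨A * F, (rank_clm_mul_le_right A F).trans hF, ?_⟩
  calc ‖A * T - A * F‖ = ‖A * (T - F)‖ := by rw [mul_sub]
    _ ≤ (‖A‖ + 1) * (ε / (‖A‖ + 1) / 2 ^ n) :=
      (norm_mul_le _ _).trans (by gcongr; linarith)
    _ = ε / 2 ^ n := by field_simp

omit [CompleteSpace H] in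
lemma littleO_mul_right (A : H →L[ℂ] H) {T : H →L[ℂ] H} (hT : T ∈ littleO) :
    T * A ∈ littleO := by
  intro ε hε
  obtain ⟨N, hN⟩ := hT (ε / (‖A‖ + 1)) (by positivity)
  refine ⟨N, fun n hn => ?_⟩
  obtain ⟨F, hF, hTF⟩ := hN n hn
  refine ⟨F * A, (rank_clm_mul_le_left F A).trans hF, ?_⟩
  calc ‖T * A - F * A‖ = ‖(T - F) * A‖ := by rw [sub_mul]
    _ ≤ (ε / (‖A‖ + 1) / 2 ^ n) * (‖A‖ + 1) :=
      (norm_mul_le _ _).trans (by gcongr; linarith)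
    _ = ε / 2 ^ n := by field_simp

omit [CompleteSpace H] in
lemma littleO_smul (c : ℂ) {T : H →L[ℂ] H} (hT : T ∈ littleO) : c • T ∈ littleO := by
  simpa using littleO_mul_left (c • (1 : H →L[ℂ] H)) hT

omit [CompleteSpace H] in
/-- Compact operators on an inner product space are norm limits of finite rank operators. -/
lemma exists_rank_le_norm_sub_le {A : H →L[ℂ] H} (hA : IsCompactOperator ⇑A) {ε : ℝ}
    (hε : 0 < ε) : ∃ (r : ℕ) (F : H →L[ℂ] H),
      (F : H →ₗ[ℂ] H).rank ≤ r ∧ ‖A - F‖ ≤ ε := by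
  have htb := (hA.isCompact_closure_image_closedBall (f := (A : H →ₗ[ℂ] H)) 1).totallyBounded
  obtain ⟨t, ht, hcov⟩ := Metric.totallyBounded_iff.mp htb ε hε
  have : FiniteDimensional ℂ (Submodule.span ℂ t) := FiniteDimensional.span_of_finite ℂ ht
  let P := (Submodule.span ℂ t).starProjection
  have hP : (P : H →ₗ[ℂ] H).rank = Module.finrank ℂ (Submodule.span ℂ t) := by
    rw [LinearMap.rank, Module.finrank_eq_rank]
    exact congrArg (fun U : Submodule ℂ H => Module.rank ℂ U)
      (Submodule.range_starProjection _)
  refine ⟨_, P * A, (rank_clm_mul_le_left P A).trans_eq hP, ?_⟩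
  refine ContinuousLinearMap.opNorm_le_of_unit_norm hε.le fun x hx => ?_
  have hmem : A x ∈ closure ((A : H →ₗ[ℂ] H) '' Metric.closedBall 0 1) :=
    subset_closure ⟨x, by simp [hx], rfl⟩
  obtain ⟨y, hy, hxy⟩ := Set.mem_iUnion₂.mp (hcov hmem)
  rw [Metric.mem_ball, dist_eq_norm] at hxy
  calc ‖(A - P * A) x‖ = ‖A x - P (A x)‖ := rfl
    _ ≤ ‖A x - y‖ := by
      rw [Submodule.starProjection_minimal]
      exact ciInf_le ⟨0, by rintro _ ⟨_, rfl⟩; positivity⟩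
        (⟨y, Submodule.subset_span hy⟩ : Submodule.span ℂ t)
    _ ≤ ε := hxy.le

lemma natCast_add_two_pow_le (r : ℕ) {n : ℕ} (hn : r ≤ n) :
    (r : Cardinal) + 2 ^ n ≤ 2 ^ (n + 1) := by
  have : r + 2 ^ n ≤ 2 ^ (n + 1) := by
    have := (Nat.lt_two_pow_self (n := n)).le
    omega
  exact_mod_cast this

lemma compact_mul_mem_littleO {A T : H →L[ℂ] H} (hA : IsCompactOperator ⇑A)
    (hT : T ∈ bigO) : A * T ∈ littleO := by
  obtain ⟨C, hC, hT⟩ := hT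
  intro ε hε
  obtain ⟨r, A₀, hr, hA₀⟩ := exists_rank_le_norm_sub_le hA (ε := ε / (2 * C)) (by positivity)
  refine ⟨r + 1, fun n hn => ?_⟩
  obtain ⟨n, rfl⟩ : ∃ m, n = m + 1 := ⟨n - 1, by omega⟩
  obtain ⟨F, hF, hTF⟩ := hT n
  refine ⟨A₀ * T + (A - A₀) * F, ?_, ?_⟩
  · exact (rank_clm_add_le _ _).trans ((add_le_add ((rank_clm_mul_le_left _ _).trans hr)
      ((rank_clm_mul_le_right _ _).trans hF)).trans (natCast_add_two_pow_le r (by omega)))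
  · calc ‖A * T - (A₀ * T + (A - A₀) * F)‖ = ‖(A - A₀) * (T - F)‖ := by
          congr 1; noncomm_ring
      _ ≤ ε / (2 * C) * (C / 2 ^ n) := (norm_mul_le _ _).trans (by gcongr)
      _ = ε / 2 ^ (n + 1) := by field_simp; ring

lemma mul_compact_mem_littleO {A T : H →L[ℂ] H} (hA : IsCompactOperator ⇑A)
    (hT : T ∈ bigO) : T * A ∈ littleO := by
  obtain ⟨C, hC, hT⟩ := hT
  intro ε hε
  obtain ⟨r, A₀, hr, hA₀⟩ := exists_rank_le_norm_sub_le hA (ε := ε / (2 * C)) (by positivity)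
  refine ⟨r + 1, fun n hn => ?_⟩
  obtain ⟨n, rfl⟩ : ∃ m, n = m + 1 := ⟨n - 1, by omega⟩
  obtain ⟨F, hF, hTF⟩ := hT n
  refine ⟨T * A₀ + F * (A - A₀), ?_, ?_⟩
  · exact (rank_clm_add_le _ _).trans ((add_le_add ((rank_clm_mul_le_right _ _).trans hr)
      ((rank_clm_mul_le_left _ _).trans hF)).trans (natCast_add_two_pow_le r (by omega)))
  · calc ‖T * A - (T * A₀ + F * (A - A₀))‖ = ‖(T - F) * (A - A₀)‖ := by
          congr 1; noncomm_ring
      _ ≤ (C / 2 ^ n) * (ε / (2 * C)) := (norm_mul_le _ _).trans (by gcongr)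
      _ = ε / 2 ^ (n + 1) := by field_simp; ring

/-- For `S ∈ bigO`, the set `ℤ S + littleO` is a `K(H)`-ideal. -/
lemma isSubideal_int_smul_add_littleO {S : H →L[ℂ] H} (hS : S ∈ bigO) :
    IsSubideal (KH (H := H)) {T | ∃ m : ℤ, T - (m : ℂ) • S ∈ littleO} := by
  refine ⟨?_, ⟨0, by simpa using littleO_zero⟩, ?_, ?_, ?_⟩
  · rintro T ⟨m, hm⟩
    have h1 : IsCompactOperator ⇑((m : ℂ) • S) := (bigO_subset_compact hS).smul (m : ℂ)
    have h2 := (littleO_subset_compact hm).add h1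
    rwa [← FunLike.coe_add, sub_add_cancel] at h2
  · rintro x ⟨m, hm⟩ y ⟨k, hk⟩
    refine ⟨m + k, ?_⟩
    convert littleO_add hm hk using 1
    push_cast
    rw [add_smul]
    abel
  · rintro x ⟨m, hm⟩
    refine ⟨-m, ?_⟩
    convert littleO_smul (-1) hm using 1
    push_cast
    module
  · rintro A hA x ⟨m, hm⟩
    refine ⟨⟨0, ?_⟩, ⟨0, ?_⟩⟩
    · convert littleO_add (littleO_mul_left A hm)
        (littleO_smul (m : ℂ) (compact_mul_mem_littleO hA hS)) using 1
      simp [mul_sub]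
    · convert littleO_add (littleO_mul_right A hm)
        (littleO_smul (m : ℂ) (mul_compact_mem_littleO hA hS)) using 1
      simp [sub_mul]

/-- An operator with approximation numbers comparable to `2 ^ (-n)` along the ranks `2 ^ n`. -/
lemma exists_mem_bigO_notMem_littleO (hinf : ¬ FiniteDimensional ℂ H) :
    ∃ S : H →L[ℂ] H, S ∈ bigO ∧ S ∉ littleO := by
  have hV : ∀ k : ℕ, ∃ V : Submodule ℂ H, Module.rank ℂ V = 2 ^ k := by
    intro k
    have hle : ((2 ^ k : ℕ) : Cardinal) ≤ Module.rank ℂ H :=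
      Cardinal.natCast_lt_aleph0.le.trans
        (not_lt.mp fun h => hinf (Module.rank_lt_aleph0_iff.mp h))
    obtain ⟨s, hs, hli⟩ := exists_finset_linearIndependent_of_le_rank hle
    refine ⟨Submodule.span ℂ (s : Set H), ?_⟩
    rw [rank_span_set hli]
    simp [hs]
  choose V hV using hV
  have hfin : ∀ k, FiniteDimensional ℂ (V k) := fun k =>
    Module.rank_lt_aleph0_iff.mp ((hV k).trans_lt (two_pow_lt_aleph0 k))
  let P : ℕ → H →L[ℂ] H := fun k => (V k).starProjection
  let f : ℕ → H →L[ℂ] H := fun k => ((2 : ℂ)⁻¹ ^ k) • P k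
  have hrank : ∀ k, (f k : H →ₗ[ℂ] H).rank ≤ 2 ^ k := by
    intro k
    have h1 : f k = P k * ((2 : ℂ)⁻¹ ^ k • (1 : H →L[ℂ] H)) := by simp [f]
    rw [h1]
    refine (rank_clm_mul_le_left _ _).trans_eq ((?_ : _ = Module.rank ℂ (V k)).trans (hV k))
    exact congrArg (fun U : Submodule ℂ H => Module.rank ℂ U)
      (Submodule.range_starProjection _)
  have hnorm : ∀ k, ‖f k‖ ≤ (2 : ℝ)⁻¹ ^ k := by
    intro k
    have h1 : ‖P k‖ ≤ 1 := Submodule.starProjection_norm_le _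
    rw [norm_smul]
    simpa using h1
  have hgeom : Summable fun k : ℕ => (2 : ℝ)⁻¹ ^ k :=
    summable_geometric_of_lt_one (by norm_num) (by norm_num)
  have hsum : Summable f := Summable.of_norm_bounded hgeom hnorm
  refine ⟨∑' k, f k, ⟨2, two_pos, fun n => ⟨∑ k ∈ Finset.range n, f k, ?_, ?_⟩⟩, fun hS => ?_⟩
  · induction n with
    | zero => simp [LinearMap.rank_zero]
    | succ n ih =>
      rw [Finset.sum_range_succ]
      exact (rank_clm_add_le _ _).trans ((add_le_add ih (hrank n)).trans_eq (by ring))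
  · rw [← hsum.sum_add_tsum_nat_add n, add_sub_cancel_left]
    refine (tsum_of_norm_bounded (g := fun k => (2 : ℝ)⁻¹ ^ n * (2 : ℝ)⁻¹ ^ k) (a := 2 / 2 ^ n)
      ?_ fun k => ?_)
    · have h1 : 2 / 2 ^ n = (2 : ℝ)⁻¹ ^ n * (1 - 2⁻¹)⁻¹ := by
        rw [inv_pow]
        norm_num [div_eq_mul_inv, mul_comm]
      rw [h1]
      exact (hasSum_geometric_of_lt_one (by norm_num) (by norm_num)).mul_left _
    · refine (hnorm _).trans_eq ?_
      rw [pow_add, mul_comm]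
  · obtain ⟨n, hn⟩ := hS (1 / 4) (by norm_num)
    obtain ⟨F, hF, hSF⟩ := hn n le_rfl
    set S := ∑' k, f k with hSdef
    obtain ⟨x, hxV, hx0, hFx⟩ : ∃ x ∈ V (n + 1), x ≠ 0 ∧ F x = 0 := by
      by_contra! hcon
      have hinj : Function.Injective ((F : H →ₗ[ℂ] H).rangeRestrict ∘ₗ (V (n + 1)).subtype) := by
        rw [injective_iff_map_eq_zero]
        intro x hx
        by_contra hx0
        exact hcon x x.2 (by simpa using hx0) (by simpa using congrArg Subtype.val hx)
      have h1 := (hV (n + 1)).symm.trans_le ((LinearMap.rank_le_of_injective _ hinj).trans hF)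
      have h2 : 2 ^ (n + 1) ≤ 2 ^ n := by exact_mod_cast h1
      exact absurd h2 (by rw [pow_succ]; have := Nat.two_pow_pos n; omega)
    have hupper : RCLike.re (inner ℂ (S x) x) ≤ 1 / 4 / 2 ^ n * ‖x‖ ^ 2 := by
      have h1 : S x = (S - F) x := by simp [hFx]
      calc RCLike.re (inner ℂ (S x) x) ≤ ‖S x‖ * ‖x‖ := re_inner_le_norm _ _
        _ ≤ (1 / 4 / 2 ^ n * ‖x‖) * ‖x‖ := by
          gcongr
          rw [h1]
          exact (S - F).le_of_opNorm_le hSF x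
        _ = _ := by ring
    have hlower : (2 : ℝ)⁻¹ ^ (n + 1) * ‖x‖ ^ 2 ≤ RCLike.re (inner ℂ (S x) x) := by
      have h1 : HasSum (fun k => f k x) (S x) :=
        hsum.hasSum.mapL (ContinuousLinearMap.apply ℂ H x)
      have h2 : HasSum (fun k => RCLike.re (inner ℂ x (f k x))) (RCLike.re (inner ℂ x (S x))) :=
        (h1.mapL (innerSL ℂ x)).mapL Complex.reCLM
      have h3 : ∀ k, RCLike.re (inner ℂ x (f k x)) = (2 : ℝ)⁻¹ ^ k * ‖P k x‖ ^ 2 := by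
        intro k
        have h4 : RCLike.re (inner ℂ (P k x) x) = ‖P k x‖ ^ 2 :=
          Submodule.re_inner_starProjection_eq_normSq _ _
        have h5 : (2 : ℂ)⁻¹ ^ k = (((2 : ℝ)⁻¹ ^ k : ℝ) : ℂ) := by push_cast; rfl
        rw [← h4, inner_re_symm]
        simp only [f, h5, smul_apply, inner_smul_left, Complex.conj_ofReal]
        exact Complex.re_ofReal_mul _ _
      rw [inner_re_symm]
      refine le_trans ?_ (le_hasSum h2 (n + 1) fun k _ => by rw [h3]; positivity)
      rw [h3]
      have h6 : P (n + 1) x = x := Submodule.starProjection_eq_self_iff.mpr hxV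
      rw [h6]
    have hpos : 0 < ‖x‖ ^ 2 := by positivity
    have h7 := le_of_mul_le_mul_right (hlower.trans hupper) hpos
    have h8 : (0 : ℝ) < 2⁻¹ ^ n := by positivity
    rw [div_eq_mul_inv (1 / 4 : ℝ), ← inv_pow, pow_succ] at h7
    linarith

/-- there is a compact operator `S` with `iS ∉ ⟨S⟩_{K(H)}`, so the
principal `K(H)`-ideal `⟨S⟩_{K(H)}` is not closed under complex scalar
multiplication. -/
theorem stmt_8 [SeparableSpace H] (hinf : ¬ FiniteDimensional ℂ H) :
    ∃ S : H →L[ℂ] H, IsCompactOperator ⇑S ∧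
      Complex.I • S ∉ genSub (KH (H := H)) {S} := by
  obtain ⟨S, hS, hS'⟩ := exists_mem_bigO_notMem_littleO hinf
  refine ⟨S, bigO_subset_compact hS, fun hmem => hS' ?_⟩
  obtain ⟨m, hm⟩ := hmem _ ⟨isSubideal_int_smul_add_littleO hS, Set.singleton_subset_iff.mpr
    ⟨1, by simpa using littleO_zero⟩⟩
  have hne : Complex.I - (m : ℂ) ≠ 0 := fun h => by
    simpa using congrArg Complex.im h
  rw [← sub_smul] at hm
  simpa [smul_smul, inv_mul_cancel₀ hne] using littleO_smul (Complex.I - (m : ℂ))⁻¹ hm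
end

section
/- There exists a compact operator T on H such that the adjoint T* does not belong to the principal linear K(H)-ideal (T)_{K(H)}; in particular, principal linear K(H)-ideals need not be self-adjoint. (Such a T is the diagonal operator diag⟨iⁿ/n⟩.) -/
open scoped BigOperators
open TopologicalSpace

variable {H : Type*} [NormedAddCommGroup H] [InnerProductSpace ℂ H] [CompleteSpace H]

set_option linter.unusedSectionVars false

/-- `Y` can be approximated within `δ` by operators of rank at most `a / δ + C`, for every
`δ > 0`; this says that the approximation numbers of `Y` are asymptotically at most `a / n`. -/
def HasApproxRank (Y : H →L[ℂ] H) (a : ℝ) : Prop :=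
  ∃ C : ℝ, ∀ δ > 0, ∃ (F : H →L[ℂ] H) (n : ℕ),
    LinearMap.rank (F : H →ₗ[ℂ] H) ≤ n ∧ (n : ℝ) ≤ a / δ + C ∧ ‖Y - F‖ ≤ δ

theorem HasApproxRank.add {Y Z : H →L[ℂ] H} {a b : ℝ} (hY : HasApproxRank Y a)
    (hZ : HasApproxRank Z b) : HasApproxRank (Y + Z) (2 * (a + b)) := by
  obtain ⟨C, hC⟩ := hY
  obtain ⟨D, hD⟩ := hZ
  refine ⟨C + D, fun δ hδ => ?_⟩
  obtain ⟨F, m, hF, hm, hYF⟩ := hC (δ / 2) (by positivity)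
  obtain ⟨G, n, hG, hn, hZG⟩ := hD (δ / 2) (by positivity)
  refine ⟨F + G, m + n, ?_, ?_, ?_⟩
  · push_cast
    exact (LinearMap.rank_add_le _ _).trans (add_le_add hF hG)
  · have h : 2 * (a + b) / δ = a / (δ / 2) + b / (δ / 2) := by field_simp
    push_cast
    linarith
  · calc ‖Y + Z - (F + G)‖ = ‖(Y - F) + (Z - G)‖ := by congr 1; abel
      _ ≤ δ := (norm_add_le _ _).trans (by linarith)

theorem HasApproxRank.mul_left {Y : H →L[ℂ] H} {a : ℝ} (hY : HasApproxRank Y a)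
    (A F₀ : H →L[ℂ] H) {r : ℝ} {m : ℕ} (hr : 0 < r)
    (hF₀ : LinearMap.rank (F₀ : H →ₗ[ℂ] H) ≤ m) (hA : ‖A - F₀‖ ≤ r) :
    HasApproxRank (A * Y) (r * a) := by
  obtain ⟨C, hC⟩ := hY
  refine ⟨C + m, fun δ hδ => ?_⟩
  obtain ⟨F, n, hF, hn, hYF⟩ := hC (δ / r) (by positivity)
  refine ⟨F₀ * Y + (A - F₀) * F, m + n, ?_, ?_, ?_⟩
  · push_cast
    exact (LinearMap.rank_add_le _ _).trans (add_le_add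
      ((LinearMap.rank_comp_le_left _ _).trans hF₀) ((LinearMap.rank_comp_le_right _ _).trans hF))
  · have h : r * a / δ = a / (δ / r) := by field_simp
    push_cast
    linarith
  · calc ‖A * Y - (F₀ * Y + (A - F₀) * F)‖ = ‖(A - F₀) * (Y - F)‖ := by congr 1; noncomm_ring
      _ ≤ ‖A - F₀‖ * ‖Y - F‖ := norm_mul_le _ _
      _ ≤ r * (δ / r) := by gcongr
      _ = δ := by field_simp

theorem HasApproxRank.mul_right {Y : H →L[ℂ] H} {a : ℝ} (hY : HasApproxRank Y a)
    (A F₀ : H →L[ℂ] H) {r : ℝ} {m : ℕ} (hr : 0 < r)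
    (hF₀ : LinearMap.rank (F₀ : H →ₗ[ℂ] H) ≤ m) (hA : ‖A - F₀‖ ≤ r) :
    HasApproxRank (Y * A) (r * a) := by
  obtain ⟨C, hC⟩ := hY
  refine ⟨C + m, fun δ hδ => ?_⟩
  obtain ⟨F, n, hF, hn, hYF⟩ := hC (δ / r) (by positivity)
  refine ⟨Y * F₀ + F * (A - F₀), m + n, ?_, ?_, ?_⟩
  · push_cast
    exact (LinearMap.rank_add_le _ _).trans (add_le_add
      ((LinearMap.rank_comp_le_right _ _).trans hF₀) ((LinearMap.rank_comp_le_left _ _).trans hF))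
  · have h : r * a / δ = a / (δ / r) := by field_simp
    push_cast
    linarith
  · calc ‖Y * A - (Y * F₀ + F * (A - F₀))‖ = ‖(Y - F) * (A - F₀)‖ := by congr 1; noncomm_ring
      _ ≤ ‖Y - F‖ * ‖A - F₀‖ := norm_mul_le _ _
      _ ≤ (δ / r) * r := by gcongr
      _ = δ := by field_simp

theorem isCompactOperator_of_rank_le {F : H →L[ℂ] H} {n : ℕ}
    (hF : LinearMap.rank (F : H →ₗ[ℂ] H) ≤ n) : IsCompactOperator F := by
  have hfin : FiniteDimensional ℂ (LinearMap.range (F : H →ₗ[ℂ] H)) :=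
    Module.rank_lt_aleph0_iff.1 (hF.trans_lt Cardinal.natCast_lt_aleph0)
  have : ProperSpace (LinearMap.range (F : H →ₗ[ℂ] H)) := FiniteDimensional.proper ℂ _
  have hF' : IsCompactOperator F.rangeRestrict :=
    isCompactOperator_of_locallyCompactSpace_dom F.rangeRestrict
  exact hF'.clm_comp (LinearMap.range (F : H →ₗ[ℂ] H)).subtypeL

theorem HasApproxRank.isCompactOperator {Y : H →L[ℂ] H} {a : ℝ} (hY : HasApproxRank Y a) :
    IsCompactOperator Y := by
  obtain ⟨C, hC⟩ := hY
  have hcl : IsClosed {T : H →L[ℂ] H | IsCompactOperator T} :=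
    isClosed_setOfPred_isCompactOperator
  refine hcl.closure_subset (Metric.mem_closure_iff.2 fun ε hε => ?_)
  obtain ⟨F, n, hF, -, hYF⟩ := hC (ε / 2) (by positivity)
  exact ⟨F, isCompactOperator_of_rank_le hF, by rw [dist_eq_norm]; linarith⟩

theorem rank_starProjection_le (W : Submodule ℂ H) [FiniteDimensional ℂ W] :
    LinearMap.rank (W.starProjection : H →ₗ[ℂ] H) ≤ Module.finrank ℂ W := by
  rw [Module.finrank_eq_rank]
  refine Submodule.rank_mono ?_
  rintro _ ⟨x, rfl⟩
  exact W.starProjection_apply_mem x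

/-- Compact operators on a Hilbert space are norm limits of finite rank operators. -/
theorem IsCompactOperator.exists_rank_le {A : H →L[ℂ] H} (hA : IsCompactOperator A)
    {r : ℝ} (hr : 0 < r) : ∃ (F : H →L[ℂ] H) (m : ℕ),
      LinearMap.rank (F : H →ₗ[ℂ] H) ≤ m ∧ ‖A - F‖ ≤ r := by
  have htb : TotallyBounded (A '' Metric.closedBall 0 1) :=
    (IsCompactOperator.isCompact_closure_image_closedBall (f := (A : H →ₗ[ℂ] H)) hA
      1).totallyBounded.subset subset_closure
  obtain ⟨t, ht, hcov⟩ := Metric.totallyBounded_iff.1 htb r hr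
  have hfin : FiniteDimensional ℂ (Submodule.span ℂ t) := FiniteDimensional.span_of_finite ℂ ht
  set W := Submodule.span ℂ t
  refine ⟨W.starProjection * A, Module.finrank ℂ W, ?_, ?_⟩
  · exact (LinearMap.rank_comp_le_left _ _).trans (rank_starProjection_le W)
  · refine ContinuousLinearMap.opNorm_le_of_unit_norm hr.le fun x hx => ?_
    have hx' := hcov ⟨x, by simp [hx], rfl⟩
    simp only [Set.mem_iUnion, Metric.mem_ball, exists_prop] at hx'
    obtain ⟨y, hy, hxy⟩ := hx'
    have := W.starProjection_minimal (A x)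
    calc ‖(A - W.starProjection * A) x‖ = ⨅ w : W, ‖A x - w‖ := this
      _ ≤ ‖A x - y‖ := ciInf_le ⟨0, by rintro _ ⟨w, rfl⟩; positivity⟩
          (⟨y, Submodule.subset_span hy⟩ : W)
      _ ≤ r := by rw [← dist_eq_norm]; exact hxy.le

/-- The operators whose approximation numbers are `o(1 / n)`. -/
def IsSmall (Y : H →L[ℂ] H) : Prop := ∀ ε > 0, HasApproxRank Y ε

theorem isSmall_zero : IsSmall (0 : H →L[ℂ] H) := fun ε hε =>
  ⟨0, fun δ hδ => ⟨0, 0, by simp, by simp; positivity, by simpa using hδ.le⟩⟩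

theorem IsSmall.add {Y Z : H →L[ℂ] H} (hY : IsSmall Y) (hZ : IsSmall Z) : IsSmall (Y + Z) := by
  intro ε hε
  convert (hY (ε / 4) (by positivity)).add (hZ (ε / 4) (by positivity)) using 1
  ring

theorem IsSmall.mul_left {Y : H →L[ℂ] H} (hY : IsSmall Y) (A : H →L[ℂ] H) :
    IsSmall (A * Y) := by
  intro ε hε
  have hA : 0 < ‖A‖ + 1 := by positivity
  convert (hY (ε / (‖A‖ + 1)) (by positivity)).mul_left A 0 (m := 0) hA (by simp) (by simp) using 1
  field_simp

theorem IsSmall.mul_right {Y : H →L[ℂ] H} (hY : IsSmall Y) (A : H →L[ℂ] H) :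
    IsSmall (Y * A) := by
  intro ε hε
  have hA : 0 < ‖A‖ + 1 := by positivity
  convert (hY (ε / (‖A‖ + 1)) (by positivity)).mul_right A 0 (m := 0) hA (by simp) (by simp) using 1
  field_simp

theorem IsSmall.smul {Y : H →L[ℂ] H} (hY : IsSmall Y) (c : ℂ) : IsSmall (c • Y) := by
  simpa using hY.mul_left (c • 1)

theorem HasApproxRank.isSmall_compact_mul {T A : H →L[ℂ] H} {a : ℝ} (ha : 0 < a)
    (hT : HasApproxRank T a) (hA : IsCompactOperator A) : IsSmall (A * T) := by
  intro ε hε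
  obtain ⟨F, m, hF, hAF⟩ := hA.exists_rank_le (r := ε / a) (by positivity)
  convert hT.mul_left A F (by positivity) hF hAF using 1
  field_simp

theorem HasApproxRank.isSmall_mul_compact {T A : H →L[ℂ] H} {a : ℝ} (ha : 0 < a)
    (hT : HasApproxRank T a) (hA : IsCompactOperator A) : IsSmall (T * A) := by
  intro ε hε
  obtain ⟨F, m, hF, hAF⟩ := hA.exists_rank_le (r := ε / a) (by positivity)
  convert hT.mul_right A F (by positivity) hF hAF using 1
  field_simp

/-- The principal linear `K(H)`-ideal of `T` consists of small perturbations of multiples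
of `T`. -/
theorem exists_isSmall_of_mem_genLin {T X : H →L[ℂ] H} {a : ℝ} (ha : 0 < a)
    (hT : HasApproxRank T a) (hX : X ∈ genLin (KH (H := H)) {T}) :
    ∃ (c : ℂ) (Y : H →L[ℂ] H), IsSmall Y ∧ X = c • T + Y := by
  refine hX {X | ∃ (c : ℂ) (Y : H →L[ℂ] H), IsSmall Y ∧ X = c • T + Y}
    ⟨⟨⟨?_, ?_, ?_, ?_, ?_⟩, ?_⟩, ?_⟩
  · rintro _ ⟨c, Y, hY, rfl⟩
    exact (hT.isCompactOperator.smul c).add (hY 1 one_pos).isCompactOperator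
  · exact ⟨0, 0, isSmall_zero, by simp⟩
  · rintro _ ⟨c, Y, hY, rfl⟩ _ ⟨d, Z, hZ, rfl⟩
    exact ⟨c + d, Y + Z, hY.add hZ, by module⟩
  · rintro _ ⟨c, Y, hY, rfl⟩
    exact ⟨-c, (-1 : ℂ) • Y, hY.smul _, by module⟩
  · rintro A hA _ ⟨c, Y, hY, rfl⟩
    exact ⟨⟨0, c • (A * T) + A * Y, ((hT.isSmall_compact_mul ha hA).smul c).add (hY.mul_left A),
        by simp [mul_add]⟩,
      ⟨0, c • (T * A) + Y * A, ((hT.isSmall_mul_compact ha hA).smul c).add (hY.mul_right A),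
        by simp [add_mul]⟩⟩
  · rintro d _ ⟨c, Y, hY, rfl⟩
    exact ⟨d * c, d • Y, hY.smul d, by module⟩
  · rintro _ rfl
    exact ⟨1, 0, isSmall_zero, by simp⟩

/-- An operator acting on `2 ^ k`-dimensional subspaces as the scalar `2⁻ᵏ d`, for all `k`,
can only be small if `d = 0`. -/
theorem IsSmall.eq_zero_of_forall_smul {Y : H →L[ℂ] H} (hY : IsSmall Y)
    {V : ℕ → Submodule ℂ H} (hV : ∀ k, Module.finrank ℂ (V k) = 2 ^ k) {d : ℂ}
    (hd : ∀ k, ∀ x ∈ V k, Y x = ((1 / 2 : ℂ) ^ k * d) • x) : d = 0 := by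
  by_contra hd0
  have hdpos : 0 < ‖d‖ := norm_pos_iff.2 hd0
  obtain ⟨C, hC⟩ := hY (‖d‖ / 4) (by positivity)
  obtain ⟨k, hk⟩ := pow_unbounded_of_one_lt (2 * C) (one_lt_two (α := ℝ))
  obtain ⟨F, n, hF, hn, hYF⟩ := hC (‖d‖ * (1 / 2) ^ k / 2) (by positivity)
  have hn' : n < 2 ^ k := by
    have h : ‖d‖ / 4 / (‖d‖ * (1 / 2) ^ k / 2) = 2 ^ k / 2 := by
      rw [one_div, inv_pow]
      field_simp
      norm_num
    rw [h] at hn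
    have : (n : ℝ) < 2 ^ k := by linarith
    exact_mod_cast this
  have hfin : FiniteDimensional ℂ (V k) :=
    Module.finite_of_finrank_pos (by rw [hV]; positivity)
  have hfinF : FiniteDimensional ℂ (LinearMap.range (F : H →ₗ[ℂ] H)) :=
    Module.rank_lt_aleph0_iff.1 (hF.trans_lt Cardinal.natCast_lt_aleph0)
  have hFn : Module.finrank ℂ (LinearMap.range (F : H →ₗ[ℂ] H)) ≤ n :=
    Module.finrank_le_of_rank_le hF
  have hker := LinearMap.ker_ne_bot_of_finrank_lt
    (f := (F : H →ₗ[ℂ] H).rangeRestrict.comp (V k).subtype)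
    (by rw [hV]; omega)
  obtain ⟨⟨x, hxV⟩, hx, hx0⟩ := Submodule.exists_mem_ne_zero_of_ne_bot hker
  have hFx : F x = 0 := congrArg Subtype.val (LinearMap.mem_ker.1 hx)
  have hxpos : 0 < ‖x‖ := norm_pos_iff.2 fun h => hx0 (Subtype.ext h)
  have hle := (Y - F).le_of_opNorm_le hYF x
  rw [sub_apply, hFx, sub_zero, hd k x hxV, norm_smul, norm_mul, norm_pow]
    at hle
  have hhalf : ‖(1 / 2 : ℂ)‖ = 1 / 2 := by norm_num
  rw [hhalf] at hle
  have : 0 < ‖d‖ * (1 / 2) ^ k * ‖x‖ := by positivity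
  nlinarith

theorem exists_orthonormal_nat (hinf : ¬ FiniteDimensional ℂ H) :
    ∃ u : ℕ → H, Orthonormal ℂ u := by
  obtain ⟨w, b, -⟩ := exists_hilbertBasis ℂ H
  have hw : Infinite w := by
    by_contra h
    have : Finite w := not_infinite_iff_finite.1 h
    have := Fintype.ofFinite w
    exact hinf b.toOrthonormalBasis.toBasis.finiteDimensional_of_finite
  exact ⟨_, b.orthonormal.comp _ (Infinite.natEmbedding w).injective⟩

theorem exists_orthogonal_submodules (hinf : ¬ FiniteDimensional ℂ H) :
    ∃ V : ℕ × Bool → Submodule ℂ H, (∀ i, Module.finrank ℂ (V i) = 2 ^ i.1) ∧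
      Pairwise fun i j => V i ⟂ V j := by
  obtain ⟨u, hu⟩ := exists_orthonormal_nat hinf
  set e : (ℕ × Bool) × ℕ → ℕ := Encodable.encode
  have he : Function.Injective e := Encodable.encode_injective
  refine ⟨fun i => Submodule.span ℂ (Set.range fun j : Fin (2 ^ i.1) => u (e (i, j))), ?_, ?_⟩
  · intro i
    rw [finrank_span_eq_card, Fintype.card_fin]
    refine (hu.comp (fun j : Fin (2 ^ i.1) => e (i, j)) fun j j' h => ?_).linearIndependent
    simpa [Fin.ext_iff] using he h
  · intro i i' hii
    rw [Submodule.isOrtho_span]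
    rintro _ ⟨j, rfl⟩ _ ⟨j', rfl⟩
    exact hu.2 fun h => hii (congrArg Prod.fst (he h))

section BlockDiagonal

variable (V : ℕ × Bool → Submodule ℂ H) [∀ i, FiniteDimensional ℂ (V i)]

/-- The `k`-th block `2⁻ᵏ (1 ⊕ a)` of `blockDiagonal V a`. -/
noncomputable def diagonalBlock (a : ℂ) (k : ℕ) : H →L[ℂ] H :=
  (1 / 2 : ℂ) ^ k • ((V (k, false)).starProjection + a • (V (k, true)).starProjection)

/-- The operator acting as `2⁻ᵏ` on `V (k, false)` and as `2⁻ᵏ a` on `V (k, true)`. -/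
noncomputable def blockDiagonal (a : ℂ) : H →L[ℂ] H := ∑' k, diagonalBlock V a k

theorem norm_diagonalBlock_le {a : ℂ} (ha : ‖a‖ ≤ 1) (k : ℕ) :
    ‖diagonalBlock V a k‖ ≤ 2 * (1 / 2) ^ k := by
  have hhalf : ‖(1 / 2 : ℂ)‖ = 1 / 2 := by norm_num
  rw [diagonalBlock, norm_smul, norm_pow, hhalf, mul_comm]
  gcongr
  refine (norm_add_le _ _).trans ?_
  rw [norm_smul]
  nlinarith [(V (k, false)).starProjection_norm_le, (V (k, true)).starProjection_norm_le,
    norm_nonneg a, norm_nonneg (V (k, true)).starProjection]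

theorem hasSum_blockDiagonal {a : ℂ} (ha : ‖a‖ ≤ 1) :
    HasSum (diagonalBlock V a) (blockDiagonal V a) :=
  (Summable.of_norm_bounded (summable_geometric_two.mul_left 2)
    (norm_diagonalBlock_le V ha)).hasSum

theorem adjoint_blockDiagonal {a : ℂ} (ha : ‖a‖ ≤ 1) :
    ContinuousLinearMap.adjoint (blockDiagonal V a) = blockDiagonal V (star a) := by
  refine HasSum.unique ?_ (hasSum_blockDiagonal V (a := star a) (by simpa using ha))
  have h := (hasSum_blockDiagonal V ha).star
  have hP : ∀ i, star (V i).starProjection = (V i).starProjection := fun i =>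
    isSelfAdjoint_starProjection (V i)
  rw [ContinuousLinearMap.star_eq_adjoint] at h
  convert h using 2 with k
  simp [diagonalBlock, hP]

theorem blockDiagonal_apply {a : ℂ} (ha : ‖a‖ ≤ 1) (hV : Pairwise fun i j => V i ⟂ V j)
    (i : ℕ × Bool) {x : H} (hx : x ∈ V i) :
    blockDiagonal V a x = ((1 / 2 : ℂ) ^ i.1 * if i.2 then a else 1) • x := by
  have hself : (V i).starProjection x = x := (V i).starProjection_eq_self_iff.2 hx
  have hzero : ∀ j, j ≠ i → (V j).starProjection x = 0 := fun j hj =>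
    (V j).starProjection_apply_eq_zero_iff.2 ((hV hj).symm hx)
  have h := (hasSum_blockDiagonal V ha).mapL (ContinuousLinearMap.apply ℂ H x)
  refine h.unique ?_
  obtain ⟨k, b⟩ := i
  convert hasSum_single k fun l hl => ?_ using 1
  · cases b
    · simp [diagonalBlock, hself, hzero (k, true) (by simp)]
    · simp [diagonalBlock, hself, hzero (k, false) (by simp), smul_smul]
  · simp [diagonalBlock, hzero (l, true) (by simp [hl]), hzero (l, false) (by simp [hl])]

theorem rank_sum_diagonalBlock_le (hV : ∀ i, Module.finrank ℂ (V i) = 2 ^ i.1) (a : ℂ) (K : ℕ) :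
    LinearMap.rank ((∑ k ∈ Finset.range K, diagonalBlock V a k : H →L[ℂ] H) : H →ₗ[ℂ] H) ≤
      (2 * 2 ^ K : ℕ) := by
  have hmul : ∀ (c : ℂ) (A : H →L[ℂ] H), LinearMap.rank ((c • A : H →L[ℂ] H) : H →ₗ[ℂ] H) ≤
      LinearMap.rank (A : H →ₗ[ℂ] H) := fun c A => by
    have := LinearMap.rank_comp_le_right (A : H →ₗ[ℂ] H) (c • LinearMap.id : H →ₗ[ℂ] H)
    exact this
  induction K with
  | zero => simp
  | succ K ih =>
    rw [Finset.sum_range_succ]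
    refine (LinearMap.rank_add_le _ _).trans ?_
    have hblock : LinearMap.rank (diagonalBlock V a K : H →ₗ[ℂ] H) ≤ (2 ^ K + 2 ^ K : ℕ) := by
      refine (hmul _ _).trans ((LinearMap.rank_add_le _ _).trans ?_)
      rw [Nat.cast_add]
      refine add_le_add ?_ ((hmul _ _).trans ?_)
      · simpa only [hV] using rank_starProjection_le (V (K, false))
      · simpa only [hV] using rank_starProjection_le (V (K, true))
    refine (add_le_add ih hblock).trans ?_
    rw [← Nat.cast_add]
    exact Nat.cast_le.2 (by rw [pow_succ]; omega)

theorem hasApproxRank_blockDiagonal (hV : ∀ i, Module.finrank ℂ (V i) = 2 ^ i.1) {a : ℂ}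
    (ha : ‖a‖ ≤ 1) : HasApproxRank (blockDiagonal V a) 16 := by
  refine ⟨2, fun δ hδ => ?_⟩
  have hex : ∃ K : ℕ, 4 / δ ≤ 2 ^ K :=
    (pow_unbounded_of_one_lt (4 / δ) (one_lt_two (α := ℝ))).imp fun _ => le_of_lt
  obtain ⟨K, hK, hmin⟩ : ∃ K : ℕ, 4 / δ ≤ 2 ^ K ∧ (2 : ℝ) ^ K ≤ 8 / δ + 1 := by
    classical
    refine ⟨Nat.find hex, Nat.find_spec hex, ?_⟩
    rcases h : Nat.find hex with _ | m
    · have : 0 < 8 / δ := by positivity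
      simp [this.le]
    · have hm := Nat.find_min hex (m := m) (by omega)
      have : 8 / δ = 2 * (4 / δ) := by ring
      rw [pow_succ]
      linarith
  refine ⟨_, _, rank_sum_diagonalBlock_le V hV a K, ?_, ?_⟩
  · have : 16 / δ = 2 * (8 / δ) := by ring
    push_cast
    linarith
  · rw [norm_sub_rev]
    refine (norm_sub_le_of_geometric_bound_of_hasSum (by norm_num) (norm_diagonalBlock_le V ha)
      (hasSum_blockDiagonal V ha) K).trans ?_
    rw [div_le_iff₀ hδ] at hK
    rw [one_div, inv_pow, ← div_eq_mul_inv, div_div, div_le_iff₀ (by positivity)]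
    linarith

end BlockDiagonal

/-- there is a compact operator `T` whose adjoint does not belong to
the principal linear `K(H)`-ideal `(T)_{K(H)}`. -/
theorem stmt_10 [SeparableSpace H] (hinf : ¬ FiniteDimensional ℂ H) :
    ∃ T : H →L[ℂ] H, IsCompactOperator ⇑T ∧
      ContinuousLinearMap.adjoint T ∉ genLin (KH (H := H)) {T} := by
  obtain ⟨V, hdim, horth⟩ := exists_orthogonal_submodules hinf
  have hfin : ∀ i, FiniteDimensional ℂ (V i) := fun i =>
    Module.finite_of_finrank_pos (by rw [hdim]; positivity)
  have hI : ‖Complex.I‖ ≤ 1 := by simp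
  have hI' : ‖star Complex.I‖ ≤ 1 := by simp
  have hT := hasApproxRank_blockDiagonal V hdim hI
  refine ⟨blockDiagonal V Complex.I, hT.isCompactOperator, fun hmem => ?_⟩
  obtain ⟨c, Y, hY, hadj⟩ := exists_isSmall_of_mem_genLin (by norm_num) hT hmem
  rw [adjoint_blockDiagonal V hI] at hadj
  obtain rfl : Y = blockDiagonal V (star Complex.I) - c • blockDiagonal V Complex.I := by
    rw [hadj]; abel
  have h₁ := hY.eq_zero_of_forall_smul (V := fun k => V (k, false)) (d := 1 - c)
    (fun k => hdim _) fun k x hx => by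
      simp only [sub_apply, smul_apply,
        blockDiagonal_apply V hI horth _ hx, blockDiagonal_apply V hI' horth _ hx]
      simp only [Bool.false_eq_true, if_false]
      module
  have h₂ := hY.eq_zero_of_forall_smul (V := fun k => V (k, true))
    (d := star Complex.I - c * Complex.I)
    (fun k => hdim _) fun k x hx => by
      simp only [sub_apply, smul_apply,
        blockDiagonal_apply V hI horth _ hx, blockDiagonal_apply V hI' horth _ hx]
      simp only [if_true]
      module
  obtain rfl : c = 1 := (sub_eq_zero.1 h₁).symm
  have := congrArg Complex.im h₂
  norm_num at this
end
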